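/- (Lemma 4, self-similarity.) For every natural number a ≥ 1: if a is even then τᵃ·Σ((0,1]) = Σ((0, 1/τᵃ]), and if a is odd then τᵃ·Σ((0,1]) = Σ([−1/τᵃ, 0)); here τᵃ·Σ((0,1]) denotes the set {τᵃ·x : x ∈ Σ((0,1])} of real numbers. -/

import Mathlib

noncomputable def tau : ℝ := (1 + Real.sqrt 5) / 2
noncomputable def tau' : ℝ := (1 - Real.sqrt 5) / 2

/-- The model set Σ(Ω). -/
def modelSet (Ω : Set ℝ) : Set ℝ :=
  {x | ∃ n₁ n₂ : ℤ, x = (n₁ : ℝ) + n₂ * tau ∧ (n₁ : ℝ) + n₂ * tau' ∈ Ω}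

lemma tau_sq : tau ^ 2 = tau + 1 := by
  have h := Real.sq_sqrt (show (0 : ℝ) ≤ 5 by norm_num)
  unfold tau
  linear_combination h / 4

lemma tau'_sq : tau' ^ 2 = tau' + 1 := by
  have h := Real.sq_sqrt (show (0 : ℝ) ≤ 5 by norm_num)
  unfold tau'
  linear_combination h / 4

lemma tau_pos : 0 < tau := by
  unfold tau
  positivity

lemma tau'_eq_neg_inv_tau : tau' = -tau⁻¹ := by
  have h : tau * tau' = -1 := by
    unfold tau tau'
    linear_combination -Real.sq_sqrt (show (0 : ℝ) ≤ 5 by norm_num) / 4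
  have := tau_pos.ne'
  field_simp
  linarith

/-- Multiplying a model set by `tau` multiplies its window by `tau'`. -/
lemma image_tau_mul_modelSet (Ω : Set ℝ) :
    (fun x : ℝ => tau * x) '' modelSet Ω = modelSet ((fun x : ℝ => tau' * x) '' Ω) := by
  have h0 : tau' ≠ 0 := by
    rw [tau'_eq_neg_inv_tau]
    exact neg_ne_zero.mpr (inv_ne_zero tau_pos.ne')
  ext y
  constructor
  · rintro ⟨x, ⟨m, n, rfl, hx⟩, rfl⟩
    refine ⟨n, m + n, ?_, _, hx, ?_⟩
    · push_cast
      linear_combination (n : ℝ) * tau_sq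
    · push_cast
      linear_combination (n : ℝ) * tau'_sq
  · rintro ⟨m, n, rfl, w, hw, hwe⟩
    refine ⟨(n - m : ℤ) + m * tau, ⟨n - m, m, rfl, ?_⟩, ?_⟩
    · convert hw using 1
      apply mul_left_cancel₀ h0
      push_cast
      linear_combination (m : ℝ) * tau'_sq - hwe
    · push_cast
      linear_combination (m : ℝ) * tau_sq

lemma image_tau_pow_mul_modelSet (a : ℕ) (Ω : Set ℝ) :
    (fun x : ℝ => tau ^ a * x) '' modelSet Ω
      = modelSet ((fun x : ℝ => tau' ^ a * x) '' Ω) := by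
  induction a with
  | zero => simp
  | succ a ih =>
    have hcomp (t : ℝ) (S : Set ℝ) :
        (fun x : ℝ => t ^ (a + 1) * x) '' S
          = (fun x : ℝ => t * x) '' ((fun x : ℝ => t ^ a * x) '' S) := by
      rw [Set.image_image]
      simp only [pow_succ', mul_assoc]
    rw [hcomp, hcomp, ih, image_tau_mul_modelSet]

/-- Lemma 4 (self-similarity): τᵃ·Σ((0,1]) = Σ((0,1/τᵃ]) for a even,
and τᵃ·Σ((0,1]) = Σ([−1/τᵃ,0)) for a odd. -/
theorem stmt13_self_similarity (a : ℕ) (ha : 1 ≤ a) :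
    (Even a →
      (fun x : ℝ => tau ^ a * x) '' modelSet (Set.Ioc 0 1)
        = modelSet (Set.Ioc 0 (1 / tau ^ a))) ∧
    (Odd a →
      (fun x : ℝ => tau ^ a * x) '' modelSet (Set.Ioc 0 1)
        = modelSet (Set.Ico (-(1 / tau ^ a)) 0)) := by
  have hpos : 0 < (tau ^ a)⁻¹ := inv_pos.mpr (pow_pos tau_pos a)
  rw [image_tau_pow_mul_modelSet, tau'_eq_neg_inv_tau]
  constructor <;> intro h
  · rw [h.neg_pow, inv_pow, Set.image_mul_left_Ioc hpos, mul_zero, mul_one, one_div]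
  · simp only [h.neg_pow, inv_pow, neg_mul]
    rw [← Set.image_image (fun x : ℝ => -x) (fun x => (tau ^ a)⁻¹ * x),
      Set.image_mul_left_Ioc hpos, Set.image_neg_Ioc, mul_zero, mul_one, neg_zero, one_div]
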